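/- Subadditivity of level curves: let c be a speed function and v₀ nondecreasing and 1-Lipschitz; for wedge-ordered pairs define Γ̃_c((x₁,y₁),(x₂,y₂)) := Γ_c((x₁+y₁, y₁), (x₂+y₂, y₂)) whenever x₁+y₁ ≤ x₂+y₂ and y₁ ≤ y₂. Fix q₀, q, x ∈ ℝ, t > 0, and 0 < h < t, and assume all superlevel sets appearing below are nonempty and closed (as holds under the paper's regularity assumptions). Set y₁ := g^{q₀}(q−q₀, t−h) and define ḡ(x−q) := inf{ y ≥ β(x−q) : Γ̃_c( (q, y₁ − v₀(q₀)), (x, y + y₁ − v₀(q₀)) ) ≥ h }. Then g^{q₀}(q−q₀, t−h) + ḡ(x−q) ≥ g^{q₀}(x−q₀, t). -/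

import Mathlib

open MeasureTheory

/-- `ψ(y)`: the negative Legendre dual of the TASEP flux, given piecewise. -/
noncomputable def psi (y : ℝ) : ℝ :=
  if y < -1 then -y else if y ≤ 1 then (1 - y) ^ 2 / 4 else 0

/-- The homogeneous exponential last-passage shape function `γ(x,y) = (√x + √y)²`. -/
noncomputable def gam (x y : ℝ) : ℝ := (Real.sqrt x + Real.sqrt y) ^ 2

/-- The lower wedge boundary `β(x) = max(0, −x)`. -/
def beta (x : ℝ) : ℝ := max 0 (-x)

/-- A speed function: Borel measurable, strictly positive, and on every compact set
bounded above and bounded below away from `0`. -/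
def SpeedFunction (c : ℝ × ℝ → ℝ) : Prop :=
  Measurable c ∧ (∀ z, 0 < c z) ∧
    ∀ K : Set (ℝ × ℝ), IsCompact K →
      ∃ m M : ℝ, 0 < m ∧ ∀ z ∈ K, m ≤ c z ∧ c z ≤ M

/-- An admissible macroscopic path from `A` to `B`: continuous on `[0,1]`, piecewise `C¹`
(differentiable off a finite set), with nonnegative derivative components. -/
structure AdmissiblePath (A B : ℝ × ℝ) where
  p : ℝ → ℝ × ℝ
  cont : ContinuousOn p (Set.Icc 0 1)
  init : p 0 = A
  ep : p 1 = B
  pw : ∃ T : Finset ℝ, ∀ s ∈ Set.Ioo (0 : ℝ) 1, s ∉ T →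
    DifferentiableAt ℝ p s ∧ 0 ≤ (deriv p s).1 ∧ 0 ≤ (deriv p s).2

/-- The weight `∫₀¹ γ(x₁′(s), x₂′(s)) / c(x(s)) ds` collected by a path. -/
noncomputable def pathWeight (c : ℝ × ℝ → ℝ) (p : ℝ → ℝ × ℝ) : ℝ :=
  ∫ s in (0 : ℝ)..1, gam (deriv p s).1 (deriv p s).2 / c (p s)

/-- The macroscopic two-point last-passage value `Γ_c(A,B)`, a supremum over admissible
paths from `A` to `B`. -/
noncomputable def Gamma (c : ℝ × ℝ → ℝ) (A B : ℝ × ℝ) : ℝ :=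
  sSup { w : ℝ | ∃ P : AdmissiblePath A B, w = pathWeight c P.p }

/-- The `q`-shifted shape function
`Γ_c^q(x,y) = Γ_c((q − v₀(q), −v₀(q)), (x + q − v₀(q), y − v₀(q)))`. -/
noncomputable def GammaQ (c : ℝ × ℝ → ℝ) (v₀ : ℝ → ℝ) (q x y : ℝ) : ℝ :=
  Gamma c (q - v₀ q, -v₀ q) (x + q - v₀ q, y - v₀ q)

/-- The level curve `g^q(x,t) = inf{ y ≥ β(x) : Γ_c^q(x+y, y) ≥ t }`. -/
noncomputable def levelCurve (c : ℝ × ℝ → ℝ) (v₀ : ℝ → ℝ) (q x t : ℝ) : ℝ :=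
  sInf { y : ℝ | beta x ≤ y ∧ t ≤ GammaQ c v₀ q (x + y) y }

/-- The wedge last-passage value `Γ̃_c((x₁,y₁),(x₂,y₂)) = Γ_c((x₁+y₁,y₁),(x₂+y₂,y₂))`. -/
noncomputable def GammaW (c : ℝ × ℝ → ℝ) (P Q : ℝ × ℝ) : ℝ :=
  Gamma c (P.1 + P.2, P.2) (Q.1 + Q.2, Q.2)


lemma le_of_deriv_off_finite (f : ℝ → ℝ) (T : Finset ℝ) : ∀ a b : ℝ, a ≤ b →
    ContinuousOn f (Set.Icc a b) →
    (∀ s ∈ Set.Ioo a b, s ∉ T → DifferentiableAt ℝ f s ∧ 0 ≤ deriv f s) → f a ≤ f b := by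
  classical
  induction T using Finset.induction_on with
  | empty =>
    intro a b hab hc hd
    have : MonotoneOn f (Set.Icc a b) := by
      apply monotoneOn_of_deriv_nonneg (convex_Icc a b) hc
      · rw [interior_Icc]
        intro s hs
        exact (hd s hs (by simp)).1.differentiableWithinAt
      · rw [interior_Icc]
        intro s hs
        exact (hd s hs (by simp)).2
    exact this (Set.left_mem_Icc.2 hab) (Set.right_mem_Icc.2 hab) hab
  | insert u T hu ih =>
    intro a b hab hc hd
    by_cases hm : u ∈ Set.Ioo a b
    · have h1 := ih a u hm.1.le (hc.mono (Set.Icc_subset_Icc le_rfl hm.2.le)) (by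
        intro s hs hT
        refine hd s ⟨hs.1, hs.2.trans hm.2⟩ ?_
        simp [hT, hs.2.ne])
      have h2 := ih u b hm.2.le (hc.mono (Set.Icc_subset_Icc hm.1.le le_rfl)) (by
        intro s hs hT
        refine hd s ⟨hm.1.trans hs.1, hs.2⟩ ?_
        simp [hT, hs.1.ne'])
      exact h1.trans h2
    · apply ih a b hab hc
      intro s hs hT
      refine hd s hs ?_
      have : s ≠ u := by rintro rfl; exact hm hs
      simp [hT, this]

lemma mono_of_deriv_off_finite (f : ℝ → ℝ) (T : Finset ℝ) (hc : ContinuousOn f (Set.Icc 0 1))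
    (hd : ∀ s ∈ Set.Ioo (0:ℝ) 1, s ∉ T → DifferentiableAt ℝ f s ∧ 0 ≤ deriv f s) :
    MonotoneOn f (Set.Icc 0 1) := by
  intro a ha b hb hab
  apply le_of_deriv_off_finite f T a b hab (hc.mono (Set.Icc_subset_Icc ha.1 hb.2))
  intro s hs
  exact hd s ⟨ha.1.trans_lt hs.1, hs.2.trans_le hb.2⟩

lemma gam_le {u v : ℝ} (hu : 0 ≤ u) (hv : 0 ≤ v) : gam u v ≤ 2 * (u + v) := by
  unfold gam
  nlinarith [Real.sq_sqrt hu, Real.sq_sqrt hv, sq_nonneg (Real.sqrt u - Real.sqrt v)]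

lemma gam_nonneg (u v : ℝ) : 0 ≤ gam u v := sq_nonneg _

lemma gam_two (u v : ℝ) : gam (2 * u) (2 * v) = 2 * gam u v := by
  unfold gam
  rw [Real.sqrt_mul (by norm_num), Real.sqrt_mul (by norm_num), ← mul_add, mul_pow,
    Real.sq_sqrt (by norm_num)]

lemma fst_d {p : ℝ → ℝ × ℝ} {s : ℝ} (h : DifferentiableAt ℝ p s) :
    HasDerivAt (fun s => (p s).1) (deriv p s).1 s := h.hasDerivAt.fst

lemma snd_d {p : ℝ → ℝ × ℝ} {s : ℝ} (h : DifferentiableAt ℝ p s) :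
    HasDerivAt (fun s => (p s).2) (deriv p s).2 s := h.hasDerivAt.snd

lemma path_bound (c : ℝ × ℝ → ℝ) (hc : SpeedFunction c) (A B : ℝ × ℝ) :
    ∃ K : ℝ, ∀ P : AdmissiblePath A B,
      IntervalIntegrable (fun s => gam (deriv P.p s).1 (deriv P.p s).2 / c (P.p s)) volume 0 1 ∧
      pathWeight c P.p ≤ K := by
  obtain ⟨hcm, hcp, hcK⟩ := hc
  obtain ⟨m, M, hm, hmM⟩ := hcK (Set.Icc A B) isCompact_Icc
  refine ⟨2 / m * ((B.1 - A.1) + (B.2 - A.2)), fun P => ?_⟩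
  obtain ⟨T, hT⟩ := P.pw
  set f : ℝ → ℝ := fun s => (P.p s).1 with hf
  set g : ℝ → ℝ := fun s => (P.p s).2 with hg
  have fm : MonotoneOn f (Set.Icc 0 1) := mono_of_deriv_off_finite f T P.cont.fst (by
    intro s hs h
    obtain ⟨h1, h2, h3⟩ := hT s hs h
    exact ⟨(fst_d h1).differentiableAt, by rw [hf, (fst_d h1).deriv]; exact h2⟩)
  have gm : MonotoneOn g (Set.Icc 0 1) := mono_of_deriv_off_finite g T P.cont.snd (by
    intro s hs h
    obtain ⟨h1, h2, h3⟩ := hT s hs h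
    exact ⟨(snd_d h1).differentiableAt, by rw [hg, (snd_d h1).deriv]; exact h3⟩)
  have f0 : f 0 = A.1 := by simp [hf, P.init]
  have f1 : f 1 = B.1 := by simp [hf, P.ep]
  have g0 : g 0 = A.2 := by simp [hg, P.init]
  have g1 : g 1 = B.2 := by simp [hg, P.ep]
  have z0 : (0:ℝ) ∈ Set.Icc (0:ℝ) 1 := by simp
  have z1 : (1:ℝ) ∈ Set.Icc (0:ℝ) 1 := by simp
  have hin : ∀ s ∈ Set.Icc (0:ℝ) 1, m ≤ c (P.p s) := by
    intro s hs
    refine (hmM _ ⟨⟨?_, ?_⟩, ⟨?_, ?_⟩⟩).1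
    · rw [← f0]; exact fm z0 hs hs.1
    · rw [← g0]; exact gm z0 hs hs.1
    · rw [← f1]; exact fm hs z1 hs.2
    · rw [← g1]; exact gm hs z1 hs.2
  have uI : Set.uIcc (0:ℝ) 1 = Set.Icc 0 1 := Set.uIcc_of_le zero_le_one
  have fi : IntervalIntegrable (deriv f) volume 0 1 :=
    MonotoneOn.intervalIntegrable_deriv (by rw [uI]; exact fm)
  have gi : IntervalIntegrable (deriv g) volume 0 1 :=
    MonotoneOn.intervalIntegrable_deriv (by rw [uI]; exact gm)
  have fb : ∫ s in (0:ℝ)..1, deriv f s ≤ B.1 - A.1 := by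
    have := MonotoneOn.intervalIntegral_deriv_mem_uIcc (f := f) (a := 0) (b := 1)
      (by rw [uI]; exact fm)
    rw [Set.uIcc_of_le (by linarith [fm z0 z1 zero_le_one]), f0, f1] at this
    exact this.2
  have gb : ∫ s in (0:ℝ)..1, deriv g s ≤ B.2 - A.2 := by
    have := MonotoneOn.intervalIntegral_deriv_mem_uIcc (f := g) (a := 0) (b := 1)
      (by rw [uI]; exact gm)
    rw [Set.uIcc_of_le (by linarith [gm z0 z1 zero_le_one]), g0, g1] at this
    exact this.2
  have hG : IntervalIntegrable (fun s => 2 / m * (deriv f s + deriv g s)) volume 0 1 :=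
    (fi.add gi).const_mul _
  have hle : ∀ᵐ s ∂(volume.restrict (Set.Ioc (0:ℝ) 1)),
      gam (deriv P.p s).1 (deriv P.p s).2 / c (P.p s) ≤ 2 / m * (deriv f s + deriv g s) := by
    rw [← restrict_Ioo_eq_restrict_Ioc]
    have hTae : ∀ᵐ s ∂(volume.restrict (Set.Ioo (0:ℝ) 1)), s ∉ T := by
      have : ∀ᵐ s ∂(volume : Measure ℝ), s ∉ (T : Set ℝ) :=
        (T.finite_toSet.measure_zero volume : _) |> measure_eq_zero_iff_ae_notMem.1
      exact ae_restrict_of_ae (by simpa using this)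
    filter_upwards [hTae, ae_restrict_mem measurableSet_Ioo] with s hs hs'
    obtain ⟨h1, h2, h3⟩ := hT s hs' hs
    rw [hf, hg, (fst_d h1).deriv, (snd_d h1).deriv]
    have hms := hin s ⟨hs'.1.le, hs'.2.le⟩
    calc _ ≤ (2 * ((deriv P.p s).1 + (deriv P.p s).2)) / m := by
          apply div_le_div₀ (by positivity) (gam_le h2 h3) hm hms
      _ = _ := by ring
  have hmeas : AEStronglyMeasurable
      (fun s => gam (deriv P.p s).1 (deriv P.p s).2 / c (P.p s))
      (volume.restrict (Set.Ioc (0:ℝ) 1)) := by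
    apply AEMeasurable.aestronglyMeasurable
    apply AEMeasurable.div
    · apply Measurable.aemeasurable
      have := measurable_deriv P.p
      unfold gam
      fun_prop
    · exact hcm.comp_aemeasurable
        ((P.cont.mono Set.Ioc_subset_Icc_self).aemeasurable measurableSet_Ioc)
  have hint : IntervalIntegrable
      (fun s => gam (deriv P.p s).1 (deriv P.p s).2 / c (P.p s)) volume 0 1 := by
    rw [intervalIntegrable_iff_integrableOn_Ioc_of_le zero_le_one] at hG ⊢
    refine Integrable.mono' hG hmeas ?_
    filter_upwards [hle] with s hs
    rw [Real.norm_of_nonneg (div_nonneg (gam_nonneg _ _) (hcp _).le)]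
    exact hs
  refine ⟨hint, ?_⟩
  unfold pathWeight
  calc _ ≤ ∫ s in (0:ℝ)..1, 2 / m * (deriv f s + deriv g s) := by
        rw [intervalIntegral.integral_of_le zero_le_one,
          intervalIntegral.integral_of_le zero_le_one]
        exact integral_mono_ae hint.1 hG.1 hle
    _ = 2 / m * ((∫ s in (0:ℝ)..1, deriv f s) + ∫ s in (0:ℝ)..1, deriv g s) := by
        rw [intervalIntegral.integral_const_mul, intervalIntegral.integral_add fi gi]
    _ ≤ _ := by gcongr

noncomputable def catP (p r : ℝ → ℝ × ℝ) (s : ℝ) : ℝ × ℝ :=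
  if s ≤ 1 / 2 then p (2 * s) else r (2 * s - 1)

lemma catP_left (p r : ℝ → ℝ × ℝ) {s : ℝ} (hs : s < 1 / 2) :
    catP p r =ᶠ[nhds s] fun u => p (2 * u) := by
  filter_upwards [Iio_mem_nhds hs] with u hu
  simp [catP, le_of_lt (Set.mem_Iio.1 hu)]
  intro h
  exfalso
  have := Set.mem_Iio.1 hu
  norm_num at this
  linarith

lemma catP_right (p r : ℝ → ℝ × ℝ) {s : ℝ} (hs : 1 / 2 < s) :
    catP p r =ᶠ[nhds s] fun u => r (2 * u - 1) := by
  filter_upwards [Ioi_mem_nhds hs] with u hu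
  exact if_neg (not_le.2 hu)

lemma deriv_left (p r : ℝ → ℝ × ℝ) {s : ℝ} (hs : s < 1 / 2) :
    deriv (catP p r) s = (2:ℝ) • deriv p (2 * s) := by
  rw [(catP_left p r hs).deriv_eq, deriv_comp_mul_left]

lemma deriv_right (p r : ℝ → ℝ × ℝ) {s : ℝ} (hs : 1 / 2 < s) :
    deriv (catP p r) s = (2:ℝ) • deriv r (2 * s - 1) := by
  rw [(catP_right p r hs).deriv_eq, deriv_comp_mul_left 2 (fun u => r (u - 1)),
    deriv_comp_sub_const]

noncomputable def catPath {A B C : ℝ × ℝ} (P : AdmissiblePath A B) (Q : AdmissiblePath B C) :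
    AdmissiblePath A C where
  p := catP P.p Q.p
  cont := by
    have h1 : ContinuousOn (catP P.p Q.p) (Set.Icc 0 (1/2)) := by
      have : ContinuousOn (fun s : ℝ => P.p (2 * s)) (Set.Icc 0 (1/2)) :=
        P.cont.comp (by fun_prop) (by intro s hs; constructor <;> linarith [hs.1, hs.2])
      refine this.congr ?_
      intro s hs
      exact if_pos hs.2
    have h2 : ContinuousOn (catP P.p Q.p) (Set.Icc (1/2) 1) := by
      have : ContinuousOn (fun s : ℝ => Q.p (2 * s - 1)) (Set.Icc (1/2) 1) :=
        Q.cont.comp (by fun_prop) (by intro s hs; constructor <;> linarith [hs.1, hs.2])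
      refine this.congr ?_
      intro s hs
      rcases hs.1.eq_or_lt with h | h
      · subst h
        simp [catP, P.ep, Q.init]
      · exact if_neg (not_le.2 h)
    have := h1.union_of_isClosed h2 isClosed_Icc isClosed_Icc
    rwa [Set.Icc_union_Icc_eq_Icc (by norm_num) (by norm_num)] at this
  init := by simp [catP, P.init]
  ep := by
    have : ¬ ((1:ℝ) ≤ 1 / 2) := by norm_num
    simp only [catP, if_neg this]
    norm_num [Q.ep]
  pw := by
    classical
    obtain ⟨T1, h1⟩ := P.pw
    obtain ⟨T2, h2⟩ := Q.pw
    refine ⟨insert (1/2) (T1.image (fun s => s / 2) ∪ T2.image (fun s => (s + 1) / 2)), ?_⟩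
    intro s hs hT
    simp only [Finset.mem_insert, Finset.mem_union, Finset.mem_image, not_or] at hT
    obtain ⟨ha, hb, hd⟩ := hT
    rcases lt_or_gt_of_ne ha with h | h
    · obtain ⟨k1, k2, k3⟩ := h1 (2 * s) ⟨by linarith [hs.1], by linarith⟩
        (fun hm => hb ⟨_, hm, by ring⟩)
      refine ⟨?_, ?_, ?_⟩
      · rw [(catP_left _ _ h).differentiableAt_iff]
        exact k1.comp s (by fun_prop : DifferentiableAt ℝ (fun u : ℝ => 2 * u) s)
      · rw [deriv_left _ _ h]; simpa using k2
      · rw [deriv_left _ _ h]; simpa using k3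
    · obtain ⟨k1, k2, k3⟩ := h2 (2 * s - 1) ⟨by linarith, by linarith [hs.2]⟩
        (fun hm => hd ⟨_, hm, by ring⟩)
      refine ⟨?_, ?_, ?_⟩
      · rw [(catP_right _ _ h).differentiableAt_iff]
        exact k1.comp s (by fun_prop : DifferentiableAt ℝ (fun u : ℝ => 2 * u - 1) s)
      · rw [deriv_right _ _ h]; simpa using k2
      · rw [deriv_right _ _ h]; simpa using k3

lemma catPath_weight (c : ℝ × ℝ → ℝ) (hc : SpeedFunction c) {A B C : ℝ × ℝ}
    (P : AdmissiblePath A B) (Q : AdmissiblePath B C) :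
    pathWeight c (catPath P Q).p = pathWeight c P.p + pathWeight c Q.p := by
  obtain ⟨K, hK⟩ := path_bound c hc A C
  have hI := (hK (catPath P Q)).1
  unfold pathWeight
  rw [← intervalIntegral.integral_add_adjacent_intervals (b := 1/2)
    (hI.mono_set (by
      rw [Set.uIcc_of_le (by norm_num), Set.uIcc_of_le (by norm_num)]
      exact Set.Icc_subset_Icc le_rfl (by norm_num)))
    (hI.mono_set (by
      rw [Set.uIcc_of_le (by norm_num), Set.uIcc_of_le (by norm_num)]
      exact Set.Icc_subset_Icc (by norm_num) le_rfl))]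
  congr 1
  · rw [intervalIntegral.integral_congr_Ioo_of_le
      (g := fun s => 2 * (fun s => gam (deriv P.p s).1 (deriv P.p s).2 / c (P.p s)) (2 * s))
      (by norm_num)]
    · rw [intervalIntegral.integral_const_mul, intervalIntegral.integral_comp_mul_left
        (fun s => gam (deriv P.p s).1 (deriv P.p s).2 / c (P.p s)) (by norm_num)]
      norm_num
      ring
    · intro s hs
      change gam (deriv (catP P.p Q.p) s).1 (deriv (catP P.p Q.p) s).2 / c (catP P.p Q.p s) = _
      rw [deriv_left _ _ hs.2, (catP_left P.p Q.p hs.2).eq_of_nhds]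
      simp only [Prod.smul_fst, Prod.smul_snd, smul_eq_mul, gam_two]
      ring
  · rw [intervalIntegral.integral_congr_Ioo_of_le
      (g := fun s => 2 * (fun s => gam (deriv Q.p s).1 (deriv Q.p s).2 / c (Q.p s)) (2 * s - 1))
      (by norm_num)]
    · rw [intervalIntegral.integral_const_mul, intervalIntegral.integral_comp_mul_sub
        (fun s => gam (deriv Q.p s).1 (deriv Q.p s).2 / c (Q.p s)) (by norm_num)]
      norm_num
      ring
    · intro s hs
      change gam (deriv (catP P.p Q.p) s).1 (deriv (catP P.p Q.p) s).2 / c (catP P.p Q.p s) = _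
      rw [deriv_right _ _ hs.1, (catP_right P.p Q.p hs.1).eq_of_nhds]
      simp only [Prod.smul_fst, Prod.smul_snd, smul_eq_mul, gam_two]
      ring

lemma Gamma_superadd (c : ℝ × ℝ → ℝ) (hc : SpeedFunction c) (A B C : ℝ × ℝ)
    (h1 : 0 < Gamma c A B) (h2 : 0 < Gamma c B C) :
    Gamma c A B + Gamma c B C ≤ Gamma c A C := by
  have ne1 : { w : ℝ | ∃ P : AdmissiblePath A B, w = pathWeight c P.p }.Nonempty := by
    by_contra h
    rw [Set.not_nonempty_iff_eq_empty] at h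
    rw [Gamma, h, Real.sSup_empty] at h1
    exact lt_irrefl _ h1
  have ne2 : { w : ℝ | ∃ P : AdmissiblePath B C, w = pathWeight c P.p }.Nonempty := by
    by_contra h
    rw [Set.not_nonempty_iff_eq_empty] at h
    rw [Gamma, h, Real.sSup_empty] at h2
    exact lt_irrefl _ h2
  obtain ⟨K, hK⟩ := path_bound c hc A C
  rw [← le_sub_iff_add_le]
  refine csSup_le ne1 ?_
  rintro _ ⟨P, rfl⟩
  rw [le_sub_comm]
  refine csSup_le ne2 ?_
  rintro _ ⟨Q, rfl⟩
  rw [le_sub_iff_add_le, add_comm, ← catPath_weight c hc]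
  refine le_csSup ⟨K, ?_⟩ ⟨catPath P Q, rfl⟩
  rintro _ ⟨R, rfl⟩
  exact (hK R).2

/-- Subadditivity of level curves:
`g^{q₀}(q−q₀, t−h) + ḡ(x−q) ≥ g^{q₀}(x−q₀, t)`, where `ḡ` is the `h`-level curve
restarted from the point `(q, g^{q₀}(q−q₀,t−h) − v₀(q₀))`. -/
theorem stmt_11 (c : ℝ × ℝ → ℝ) (hc : SpeedFunction c)
    (v₀ : ℝ → ℝ) (hmono : Monotone v₀) (hlip : LipschitzWith 1 v₀)
    (q₀ q x t h : ℝ) (hh : 0 < h) (hht : h < t)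
    (hS1ne : {y : ℝ | beta (q - q₀) ≤ y ∧
      t - h ≤ GammaQ c v₀ q₀ (q - q₀ + y) y}.Nonempty)
    (hS1cl : IsClosed {y : ℝ | beta (q - q₀) ≤ y ∧
      t - h ≤ GammaQ c v₀ q₀ (q - q₀ + y) y})
    (hS2ne : {y : ℝ | beta (x - q) ≤ y ∧
      h ≤ GammaW c (q, levelCurve c v₀ q₀ (q - q₀) (t - h) - v₀ q₀)
        (x, y + levelCurve c v₀ q₀ (q - q₀) (t - h) - v₀ q₀)}.Nonempty)
    (hS2cl : IsClosed {y : ℝ | beta (x - q) ≤ y ∧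
      h ≤ GammaW c (q, levelCurve c v₀ q₀ (q - q₀) (t - h) - v₀ q₀)
        (x, y + levelCurve c v₀ q₀ (q - q₀) (t - h) - v₀ q₀)}) :
    levelCurve c v₀ q₀ (x - q₀) t ≤
      levelCurve c v₀ q₀ (q - q₀) (t - h) +
        sInf {y : ℝ | beta (x - q) ≤ y ∧
          h ≤ GammaW c (q, levelCurve c v₀ q₀ (q - q₀) (t - h) - v₀ q₀)
            (x, y + levelCurve c v₀ q₀ (q - q₀) (t - h) - v₀ q₀)} := by
  have m1 := hS1cl.csInf_mem hS1ne ⟨_, fun y hy => hy.1⟩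
  have m2 := hS2cl.csInf_mem hS2ne ⟨_, fun y hy => hy.1⟩
  change levelCurve c v₀ q₀ (q - q₀) (t - h) ∈ _ at m1
  generalize levelCurve c v₀ q₀ (q - q₀) (t - h) = y₁ at *
  generalize sInf {y : ℝ | beta (x - q) ≤ y ∧
          h ≤ GammaW c (q, y₁ - v₀ q₀) (x, y + y₁ - v₀ q₀)} = y₂ at *
  obtain ⟨b1, l1⟩ := m1
  obtain ⟨b2, l2⟩ := m2
  refine csInf_le ⟨beta (x - q₀), fun y hy => hy.1⟩ ⟨?_, ?_⟩
  · simp only [beta, max_le_iff] at *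
    constructor <;> linarith [b1.1, b1.2, b2.1, b2.2]
  · unfold GammaQ at *
    unfold GammaW at l2
    have e1 : q - q₀ + y₁ + q₀ - v₀ q₀ = q + (y₁ - v₀ q₀) := by ring
    have e2 : x - q₀ + (y₁ + y₂) + q₀ - v₀ q₀ = x + (y₂ + y₁ - v₀ q₀) := by ring
    have e3 : y₁ + y₂ - v₀ q₀ = y₂ + y₁ - v₀ q₀ := by ring
    rw [e1] at l1
    rw [e2, e3]
    dsimp only at l2
    have := Gamma_superadd c hc _ _ _ (lt_of_lt_of_le (by linarith) l1) (lt_of_lt_of_le hh l2)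
    linarith
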